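/- Let (d_A, d_B, ρ, A_1,…,A_m, B_1,…,B_n) be a finite-dimensional quantum realization and define the vector x ∈ ℝ^{(m+n)+mn} by x_{XA_i} = tr(ρ (A_i ⊗ I)), x_{XB_j} = tr(ρ (I ⊗ B_j)) and x_{A_iB_j} = tr(ρ (A_i ⊗ B_j)), where ⊗ denotes the Kronecker product. Then x belongs to the intersection E(∇K_{m,n}) ∩ RMet(∇K_{m,n}) of the elliptope and the rooted semimetric polytope of the suspension graph ∇K_{m,n}. -/

import Mathlib

open Finset Matrix Kronecker ComplexOrder

/-- The elliptope `E(∇K_{m,n})` of the suspension graph: coordinates realized by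
inner products of unit vectors `w, u_1,…,u_m, v_1,…,v_n` in `ℝ^{1+m+n}`. -/
def EllSusp (m n : ℕ) :
    Set ((Fin m → ℝ) × (Fin n → ℝ) × (Fin m → Fin n → ℝ)) :=
  {x | ∃ (w : Fin (1 + m + n) → ℝ) (u : Fin m → (Fin (1 + m + n) → ℝ))
        (v : Fin n → (Fin (1 + m + n) → ℝ)),
      (∑ k, w k * w k = 1) ∧ (∀ i, ∑ k, u i k * u i k = 1) ∧
      (∀ j, ∑ k, v j k * v j k = 1) ∧
      (∀ i, x.1 i = ∑ k, w k * u i k) ∧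
      (∀ j, x.2.1 j = ∑ k, w k * v j k) ∧
      (∀ i j, x.2.2 i j = ∑ k, u i k * v j k)}

/-- The rooted semimetric polytope `RMet(∇K_{m,n})` of the suspension graph. -/
def RMet (m n : ℕ) :
    Set ((Fin m → ℝ) × (Fin n → ℝ) × (Fin m → Fin n → ℝ)) :=
  {x | ∀ i j, -1 ≤ x.1 i + x.2.1 j + x.2.2 i j ∧
       -1 ≤ -x.1 i - x.2.1 j + x.2.2 i j ∧
       -1 ≤ x.1 i - x.2.1 j - x.2.2 i j ∧
       -1 ≤ -x.1 i + x.2.1 j - x.2.2 i j}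

open scoped MatrixOrder in
/-- A positive semidefinite matrix factors as `Cᴴ * C`. -/
lemma Matrix.PosSemidef.exists_eq_conjTranspose_mul_self {𝕜 κ : Type*} [RCLike 𝕜] [Fintype κ]
    {P : Matrix κ κ 𝕜} (hP : P.PosSemidef) : ∃ C : Matrix κ κ 𝕜, P = Cᴴ * C := by
  classical
  exact CStarAlgebra.nonneg_iff_eq_star_mul_self.mp hP.nonneg

/-- The trace of a product of two positive semidefinite matrices is nonnegative. -/
lemma Matrix.PosSemidef.trace_mul_nonneg {𝕜 κ : Type*} [RCLike 𝕜] [Fintype κ]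
    {P Q : Matrix κ κ 𝕜} (hP : P.PosSemidef) (hQ : Q.PosSemidef) : 0 ≤ (P * Q).trace := by
  obtain ⟨C, rfl⟩ := hP.exists_eq_conjTranspose_mul_self
  rw [Matrix.mul_assoc, Matrix.trace_mul_comm]
  exact (hQ.mul_mul_conjTranspose_same C).trace_nonneg

/-- If `-1 ≤ A ≤ 1` in the Loewner order, then `A * A ≤ 1`. -/
lemma posSemidef_one_sub_mul_self {κ : Type*} [Fintype κ] [DecidableEq κ]
    {A : Matrix κ κ ℂ} (h₁ : (1 - A).PosSemidef) (h₂ : (1 + A).PosSemidef) :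
    (1 - A * A).PosSemidef := by
  have h := ((h₂.conjTranspose_mul_mul_same (1 - A)).add
    (h₁.conjTranspose_mul_mul_same (1 + A))).smul (show (0 : ℂ) ≤ 1 / 2 by positivity)
  rw [h₁.isHermitian.eq, h₂.isHermitian.eq] at h
  convert h using 1
  have e : (1 - A) * (1 + A) * (1 - A) + (1 + A) * (1 - A) * (1 + A)
      = (2 : ℂ) • (1 - A * A) := by
    rw [two_smul]
    noncomm_ring
  rw [e, smul_smul]
  norm_num

/-- The matrix of real parts of the second moments of Hermitian matrices in a state is positive
semidefinite. -/
lemma posSemidef_re_trace_mul {κ ι : Type*} [Fintype κ] [Fintype ι]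
    {ρ : Matrix κ κ ℂ} (hρ : ρ.PosSemidef) {X : ι → Matrix κ κ ℂ} (hX : ∀ k, (X k).IsHermitian) :
    (Matrix.of fun k l => (ρ * (X k * X l)).trace.re).PosSemidef := by
  refine .of_dotProduct_mulVec_nonneg ?_ fun c => ?_
  · ext k l
    have h : star (ρ * (X l * X k)).trace = (ρ * (X k * X l)).trace := by
      rw [← Matrix.trace_conjTranspose, Matrix.conjTranspose_mul, Matrix.conjTranspose_mul,
        (hX k).eq, (hX l).eq, hρ.isHermitian.eq, Matrix.trace_mul_comm]
    simp [← h]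
  · set Y : Matrix κ κ ℂ := ∑ k, (c k : ℂ) • X k with hY
    have hYh : Yᴴ = Y := by
      simp [hY, Matrix.conjTranspose_sum, Matrix.conjTranspose_smul, (hX _).eq]
    have h := hρ.trace_mul_nonneg (Matrix.posSemidef_conjTranspose_mul_self Y)
    rw [hYh] at h
    have e : (ρ * (Y * Y)).trace = ∑ k, ∑ l, (c k : ℂ) * (c l * (ρ * (X k * X l)).trace) := by
      simp only [hY, Finset.sum_mul, Finset.mul_sum, Matrix.trace_sum, Matrix.smul_mul,
        Matrix.mul_smul, Matrix.trace_smul, smul_eq_mul]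
      rw [Finset.sum_comm]
      simp only [mul_left_comm]
    have h' := (Complex.le_def.mp h).1
    rw [e] at h'
    simp only [Complex.zero_re, Complex.re_sum, Complex.re_ofReal_mul] at h'
    refine h'.trans_eq ?_
    simp only [dotProduct, Matrix.mulVec, Matrix.of_apply, Pi.star_apply, star_trivial,
      Finset.mul_sum]
    exact Finset.sum_congr rfl fun _ _ => Finset.sum_congr rfl fun _ _ => by ring

/-- The pairwise correlations of contractive observables in a state are the inner products of
real unit vectors. -/
lemma exists_unit_vectors_of_observables {κ ι : Type*} [Fintype κ] [DecidableEq κ] [Fintype ι]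
    {ρ : Matrix κ κ ℂ} (hρ : ρ.PosSemidef) (hρtr : ρ.trace = 1) {X : ι → Matrix κ κ ℂ}
    (hX : ∀ k, (X k).IsHermitian) (hX₁ : ∀ k, (1 - X k).PosSemidef)
    (hX₂ : ∀ k, (1 + X k).PosSemidef) :
    ∃ v : ι → ι → ℝ, (∀ k, ∑ i, v k i * v k i = 1) ∧
      ∀ k l, k ≠ l → ∑ i, v k i * v l i = (ρ * (X k * X l)).trace.re := by
  classical
  have hd : ∀ k, 0 ≤ 1 - (ρ * (X k * X k)).trace.re := fun k => by
    have h := hρ.trace_mul_nonneg (posSemidef_one_sub_mul_self (hX₁ k) (hX₂ k))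
    rw [Matrix.mul_sub, Matrix.mul_one, Matrix.trace_sub, hρtr] at h
    simpa using (Complex.le_def.mp h).1
  obtain ⟨C, hC⟩ := ((posSemidef_re_trace_mul hρ hX).add
    (Matrix.PosSemidef.diagonal hd)).exists_eq_conjTranspose_mul_self
  have hC' : ∀ k l, ∑ i, C i k * C i l = (ρ * (X k * X l)).trace.re +
      Matrix.diagonal (fun k => 1 - (ρ * (X k * X k)).trace.re) k l := fun k l => by
    simpa [Matrix.mul_apply] using (congrFun (congrFun hC k) l).symm
  refine ⟨fun k i => C i k, fun k => ?_, fun k l hkl => ?_⟩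
  · simp [hC']
  · simp [hC', hkl]

lemma sub_kronecker {R l m n p : Type*} [Ring R] (A₁ A₂ : Matrix l m R) (B : Matrix n p R) :
    (A₁ - A₂) ⊗ₖ B = A₁ ⊗ₖ B - A₂ ⊗ₖ B := by
  ext
  simp [sub_mul]

lemma kronecker_sub {R l m n p : Type*} [Ring R] (A : Matrix l m R) (B₁ B₂ : Matrix n p R) :
    A ⊗ₖ (B₁ - B₂) = A ⊗ₖ B₁ - A ⊗ₖ B₂ := by
  ext
  simp [mul_sub]

/-- Any vector of one- and two-party expectation values arising from a
finite-dimensional quantum realization lies in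
`E(∇K_{m,n}) ∩ RMet(∇K_{m,n})`. -/
theorem quantum_mem_elliptope_inter_rmet (m n : ℕ) (dA dB : ℕ)
    (hdA : 0 < dA) (hdB : 0 < dB)
    (ρ : Matrix (Fin dA × Fin dB) (Fin dA × Fin dB) ℂ)
    (A : Fin m → Matrix (Fin dA) (Fin dA) ℂ)
    (B : Fin n → Matrix (Fin dB) (Fin dB) ℂ)
    (hρ : ρ.PosSemidef) (hρtr : ρ.trace = 1)
    (hA : ∀ i, (A i).IsHermitian) (hB : ∀ j, (B j).IsHermitian)
    (hA1 : ∀ i, (1 - A i).PosSemidef) (hA2 : ∀ i, (1 + A i).PosSemidef)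
    (hB1 : ∀ j, (1 - B j).PosSemidef) (hB2 : ∀ j, (1 + B j).PosSemidef)
    (x : (Fin m → ℝ) × (Fin n → ℝ) × (Fin m → Fin n → ℝ))
    (hxA : ∀ i, (x.1 i : ℂ) = (ρ * (A i ⊗ₖ (1 : Matrix (Fin dB) (Fin dB) ℂ))).trace)
    (hxB : ∀ j, (x.2.1 j : ℂ) = (ρ * ((1 : Matrix (Fin dA) (Fin dA) ℂ) ⊗ₖ B j)).trace)
    (hxAB : ∀ i j, (x.2.2 i j : ℂ) = (ρ * (A i ⊗ₖ B j)).trace) :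
    x ∈ EllSusp m n ∩ RMet m n := by
  constructor
  · let X : Option (Fin m ⊕ Fin n) → Matrix (Fin dA × Fin dB) (Fin dA × Fin dB) ℂ :=
      fun k => k.elim 1 (Sum.elim (fun i => A i ⊗ₖ 1) (fun j => 1 ⊗ₖ B j))
    have hX : ∀ k, (X k).IsHermitian := by
      rintro (_ | i | j)
      · exact Matrix.isHermitian_one
      · simp [X, Matrix.IsHermitian, Matrix.conjTranspose_kronecker, (hA i).eq]
      · simp [X, Matrix.IsHermitian, Matrix.conjTranspose_kronecker, (hB j).eq]
    have hX₁ : ∀ k, (1 - X k).PosSemidef := by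
      rintro (_ | i | j)
      · simpa [X] using Matrix.PosSemidef.zero
      · simpa [X, sub_kronecker] using
          (hA1 i).kronecker (Matrix.PosSemidef.one (n := Fin dB) (R := ℂ))
      · simpa [X, kronecker_sub] using
          (Matrix.PosSemidef.one (n := Fin dA) (R := ℂ)).kronecker (hB1 j)
    have hX₂ : ∀ k, (1 + X k).PosSemidef := by
      rintro (_ | i | j)
      · exact Matrix.PosSemidef.one.add Matrix.PosSemidef.one
      · simpa [X, Matrix.add_kronecker] using
          (hA2 i).kronecker (Matrix.PosSemidef.one (n := Fin dB) (R := ℂ))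
      · simpa [X, Matrix.kronecker_add] using
          (Matrix.PosSemidef.one (n := Fin dA) (R := ℂ)).kronecker (hB2 j)
    obtain ⟨v, hv₁, hv⟩ := exists_unit_vectors_of_observables hρ hρtr hX hX₁ hX₂
    let e : Fin (1 + m + n) ≃ Option (Fin m ⊕ Fin n) :=
      (Fintype.equivFinOfCardEq (by simp; ring)).symm
    have he : ∀ k l, ∑ i, v k (e i) * v l (e i) = ∑ i, v k i * v l i := fun k l =>
      e.sum_comp fun i => v k i * v l i
    refine ⟨fun i => v none (e i), fun a i => v (some (.inl a)) (e i),
      fun b i => v (some (.inr b)) (e i), ?_, fun i => ?_, fun j => ?_, fun i => ?_, fun j => ?_,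
      fun i j => ?_⟩
    · rw [he, hv₁]
    · rw [he, hv₁]
    · rw [he, hv₁]
    · rw [he, hv _ _ (by simp)]
      simp [X, ← hxA]
    · rw [he, hv _ _ (by simp)]
      simp [X, ← hxB]
    · rw [he, hv _ _ (by simp)]
      simp [X, ← Matrix.mul_kronecker_mul, ← hxAB]
  · intro i j
    have h₁ := hρ.trace_mul_nonneg ((hA2 i).kronecker (hB2 j))
    have h₂ := hρ.trace_mul_nonneg ((hA1 i).kronecker (hB1 j))
    have h₃ := hρ.trace_mul_nonneg ((hA2 i).kronecker (hB1 j))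
    have h₄ := hρ.trace_mul_nonneg ((hA1 i).kronecker (hB2 j))
    simp only [Matrix.add_kronecker, Matrix.kronecker_add, sub_kronecker, kronecker_sub,
      Matrix.one_kronecker_one, Matrix.mul_add, Matrix.mul_sub, Matrix.mul_one,
      Matrix.trace_add, Matrix.trace_sub, hρtr, ← hxA, ← hxB, ← hxAB] at h₁ h₂ h₃ h₄
    norm_cast at h₁ h₂ h₃ h₄
    refine ⟨?_, ?_, ?_, ?_⟩ <;> linarith
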